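/- arXiv:1009.0589 — 4 statements merged into one kernel-verified Lean document; each statement's English description precedes it below -/
import Mathlib

section
/- Let n ≥ 1 and let A be an n×n real matrix. Then there exists a symmetric positive definite n×n real matrix H such that the product H·A is symmetric if and only if A is diagonalizable over the reals, i.e., there exist an invertible real matrix P and a real diagonal matrix D with A = P·D·P⁻¹. -/
/-- Pointwise content of strong hyperbolicity: an `n × n` real matrix `A` admits a
symmetric positive definite symmetrizer `H` (i.e. `H * A` is symmetric) if and only if
`A` is diagonalizable over the reals. -/
theorem symmetrizer_iff_real_diagonalizable (n : ℕ) (hn : 1 ≤ n)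
    (A : Matrix (Fin n) (Fin n) ℝ) :
    (∃ H : Matrix (Fin n) (Fin n) ℝ, H.IsSymm ∧ H.PosDef ∧ (H * A).IsSymm) ↔
      (∃ (P : Matrix (Fin n) (Fin n) ℝ) (D : Fin n → ℝ),
        IsUnit P ∧ A = P * Matrix.diagonal D * P⁻¹) := by
  constructor
  · rintro ⟨H, -, hpd, hHA⟩
    obtain ⟨S, hS⟩ : ∃ S : Matrix (Fin n) (Fin n) ℝ, H = S.transpose * S := by
      open scoped MatrixOrder in
      obtain ⟨S, hS⟩ := CStarAlgebra.nonneg_iff_eq_star_mul_self.mp hpd.posSemidef.nonneg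
      exact ⟨S, by rw [hS, Matrix.star_eq_conjTranspose, Matrix.conjTranspose_eq_transpose_of_trivial]⟩
    have hSd : IsUnit S.det := by
      have h := hpd.det_pos
      rw [hS, Matrix.det_mul] at h
      exact isUnit_iff_ne_zero.mpr (right_ne_zero_of_mul h.ne')
    have hSt : IsUnit S.transpose.det := by rwa [Matrix.det_transpose]
    have hM : (S * A * S⁻¹).IsHermitian := by
      have e : S * A * S⁻¹ = (S⁻¹).transpose * (H * A) * S⁻¹ := by
        rw [hS, Matrix.transpose_nonsing_inv, Matrix.mul_assoc S.transpose,
          Matrix.nonsing_inv_mul_cancel_left _ _ hSt]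
      rw [e, Matrix.IsHermitian, Matrix.conjTranspose_eq_transpose_of_trivial,
        Matrix.transpose_mul, Matrix.transpose_mul, hHA.eq, Matrix.transpose_transpose,
        Matrix.mul_assoc (S⁻¹).transpose]
    have hsp := hM.spectral_theorem
    rw [Unitary.conjStarAlgAut_apply] at hsp
    set U : Matrix (Fin n) (Fin n) ℝ := (hM.eigenvectorUnitary : Matrix (Fin n) (Fin n) ℝ) with hU
    have hUU : U * star U = 1 := Unitary.coe_mul_star_self hM.eigenvectorUnitary
    have hUinv : U⁻¹ = star U := Matrix.inv_eq_right_inv hUU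
    have hUd : IsUnit U := IsUnit.of_mul_eq_one _ hUU
    refine ⟨S⁻¹ * U, hM.eigenvalues, ?_, ?_⟩
    · exact ((Matrix.isUnit_nonsing_inv_iff).mpr ((Matrix.isUnit_iff_isUnit_det S).mpr hSd)).mul hUd
    · rw [Matrix.mul_inv_rev, Matrix.nonsing_inv_nonsing_inv _ hSd, hUinv]
      have : A = S⁻¹ * (S * A * S⁻¹) * S := by
        rw [Matrix.mul_assoc S, Matrix.nonsing_inv_mul_cancel_left _ _ hSd, Matrix.mul_assoc,
          Matrix.nonsing_inv_mul _ hSd, Matrix.mul_one]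
      conv_lhs => rw [this, hsp]
      simp only [Matrix.mul_assoc]
      rfl
  · rintro ⟨P, D, hP, hA⟩
    have hPd := (Matrix.isUnit_iff_isUnit_det P).mp hP
    have hQ : IsUnit P⁻¹ := Matrix.isUnit_nonsing_inv_iff.mpr hP
    refine ⟨(P⁻¹).transpose * P⁻¹, ?_, ?_, ?_⟩
    · simp [Matrix.IsSymm, Matrix.transpose_mul]
    · rw [← Matrix.conjTranspose_eq_transpose_of_trivial]
      exact Matrix.PosDef.conjTranspose_mul_self _ (Matrix.mulVec_injective_of_isUnit hQ)
    · have e : (P⁻¹).transpose * P⁻¹ * A = (P⁻¹).transpose * Matrix.diagonal D * P⁻¹ := by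
        rw [hA, Matrix.mul_assoc, Matrix.mul_assoc P, Matrix.nonsing_inv_mul_cancel_left _ _ hPd,
          Matrix.mul_assoc]
      rw [e, Matrix.IsSymm, Matrix.transpose_mul, Matrix.transpose_mul, Matrix.transpose_transpose,
        Matrix.diagonal_transpose, Matrix.mul_assoc]
end

section
/- Let A_b : ℝ⁴ → ℝ (b = 0,1,2,3) be smooth functions of (t,x,y,z) with the component A_0 satisfying the wave equation −∂_t²A_0 + ∂_x²A_0 + ∂_y²A_0 + ∂_z²A_0 = 0. Let E_j : ℝ³ → ℝ (j = x,y,z) be smooth with ∂_x E_x + ∂_y E_y + ∂_z E_z = 0, and suppose that at t = 0: ∂_t A_j = E_j + ∂_j A_0 for j = x,y,z, and ∂_t A_0 = ∂_x A_x + ∂_y A_y + ∂_z A_z. Then the Lorentz constraint C := −∂_t A_0 + ∂_x A_x + ∂_y A_y + ∂_z A_z satisfies C = 0 and ∂_t C = 0 at every point of the initial surface {t = 0}. -/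
noncomputable section

/-- Partial derivative `∂_a f` on `ℝ⁴ = Fin 4 → ℝ`, coordinates `(t,x,y,z) = (0,1,2,3)`. -/
def pd (a : Fin 4) (f : (Fin 4 → ℝ) → ℝ) : (Fin 4 → ℝ) → ℝ :=
  fun x => fderiv ℝ f x (Pi.single a 1)

/-- Partial derivative `∂_j f` on `ℝ³ = Fin 3 → ℝ`, coordinates `(x,y,z) = (0,1,2)`. -/
def pd3 (j : Fin 3) (f : (Fin 3 → ℝ) → ℝ) : (Fin 3 → ℝ) → ℝ :=
  fun q => fderiv ℝ f q (Pi.single j 1)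

theorem pd_contDiff (a : Fin 4) {f : (Fin 4 → ℝ) → ℝ} (hf : ContDiff ℝ (⊤ : ℕ∞) f) :
    ContDiff ℝ (⊤ : ℕ∞) (pd a f) := by
  have h : ContDiff ℝ (⊤ : ℕ∞) (fderiv ℝ f) := hf.fderiv_right (by norm_cast)
  exact h.clm_apply contDiff_const

theorem pd_differentiable (a : Fin 4) {f : (Fin 4 → ℝ) → ℝ} (hf : ContDiff ℝ (⊤ : ℕ∞) f) :
    Differentiable ℝ (pd a f) :=
  (pd_contDiff a hf).differentiable (by simp)

/-- Mixed partial derivatives of a smooth function commute. -/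
theorem pd_comm (a b : Fin 4) {f : (Fin 4 → ℝ) → ℝ} (hf : ContDiff ℝ (⊤ : ℕ∞) f)
    (p : Fin 4 → ℝ) : pd a (pd b f) p = pd b (pd a f) p := by
  have h : ContDiff ℝ (⊤ : ℕ∞) (fderiv ℝ f) := hf.fderiv_right (by norm_cast)
  have hd : DifferentiableAt ℝ (fderiv ℝ f) p := h.differentiable (by simp) p
  have key : ∀ a b : Fin 4, pd a (pd b f) p
      = fderiv ℝ (fderiv ℝ f) p (Pi.single a 1) (Pi.single b 1) := by
    intro a b
    unfold pd
    rw [fderiv_clm_apply hd (differentiableAt_const _)]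
    simp
  rw [key, key]
  have hs : IsSymmSndFDerivAt ℝ f p :=
    hf.contDiffAt.isSymmSndFDerivAt (by simp [minSmoothness_of_isRCLikeNormedField]; norm_cast)
  exact hs _ _

/-- Functions agreeing on `t = 0` have the same tangential derivatives there. -/
theorem pd_tangent (j : Fin 3) {f g : (Fin 4 → ℝ) → ℝ} (hf : Differentiable ℝ f)
    (hg : Differentiable ℝ g) (h : ∀ p : Fin 4 → ℝ, p 0 = 0 → f p = g p)
    (p : Fin 4 → ℝ) (hp : p 0 = 0) : pd j.succ f p = pd j.succ g p := by
  unfold pd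
  rw [← (hf p).lineDeriv_eq_fderiv, ← (hg p).lineDeriv_eq_fderiv]
  unfold lineDeriv
  congr 1
  funext t
  apply h
  simp [hp]

/-- Spatial derivative of a function pulled back from `ℝ³`. -/
theorem pd_pullback (j : Fin 3) {e : (Fin 3 → ℝ) → ℝ} (he : Differentiable ℝ e)
    (p : Fin 4 → ℝ) :
    pd j.succ (fun y => e (fun k => y k.succ)) p = pd3 j e (fun k => p k.succ) := by
  have hd : Differentiable ℝ (fun y : Fin 4 → ℝ => e (fun k => y k.succ)) :=
    he.comp (by fun_prop)
  unfold pd pd3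
  rw [← (hd p).lineDeriv_eq_fderiv, ← (he _).lineDeriv_eq_fderiv]
  unfold lineDeriv
  congr 1
  funext t
  refine congrArg e ?_
  funext k
  simp [Pi.single_apply]

/-- If `A_0` solves the wave equation, the electric field data `E_j` is divergence free,
and at `t = 0` one has `∂_t A_j = E_j + ∂_j A_0` and `∂_t A_0 = ∂_x A_x + ∂_y A_y + ∂_z A_z`,
then the Lorentz constraint `C = −∂_t A_0 + ∂_x A_x + ∂_y A_y + ∂_z A_z` satisfies
`C = 0` and `∂_t C = 0` on the initial surface `{t = 0}`. -/
theorem lorentz_constraint_vanishes_initially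
    (A : Fin 4 → (Fin 4 → ℝ) → ℝ) (hA : ∀ b, ContDiff ℝ (⊤ : ℕ∞) (A b))
    (hwave : ∀ x : Fin 4 → ℝ,
      -pd 0 (pd 0 (A 0)) x + pd 1 (pd 1 (A 0)) x + pd 2 (pd 2 (A 0)) x
        + pd 3 (pd 3 (A 0)) x = 0)
    (E : Fin 3 → (Fin 3 → ℝ) → ℝ) (hE : ∀ j, ContDiff ℝ (⊤ : ℕ∞) (E j))
    (hGauss : ∀ q : Fin 3 → ℝ, ∑ j, pd3 j (E j) q = 0)
    (hinitj : ∀ p : Fin 4 → ℝ, p 0 = 0 → ∀ j : Fin 3,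
      pd 0 (A j.succ) p = E j (fun k => p k.succ) + pd j.succ (A 0) p)
    (hinit0 : ∀ p : Fin 4 → ℝ, p 0 = 0 →
      pd 0 (A 0) p = ∑ j : Fin 3, pd j.succ (A j.succ) p) :
    ∀ p : Fin 4 → ℝ, p 0 = 0 →
      (-pd 0 (A 0) p + ∑ j : Fin 3, pd j.succ (A j.succ) p = 0) ∧
      pd 0 (fun y => -pd 0 (A 0) y + ∑ j : Fin 3, pd j.succ (A j.succ) y) p = 0 := by
  intro p hp
  refine ⟨by rw [hinit0 p hp]; ring, ?_⟩
  have hterm : ∀ j : Fin 3, pd 0 (pd j.succ (A j.succ)) p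
      = pd3 j (E j) (fun k => p k.succ) + pd j.succ (pd j.succ (A 0)) p := by
    intro j
    have hEd : Differentiable ℝ (E j) := (hE j).differentiable (by simp)
    have hd : Differentiable ℝ (fun y : Fin 4 → ℝ => E j (fun k => y k.succ)) :=
      hEd.comp (by fun_prop)
    have hd2 := pd_differentiable j.succ (hA 0)
    rw [pd_comm _ _ (hA _), pd_tangent j (pd_differentiable 0 (hA j.succ)) (hd.add hd2)
      (fun q hq => hinitj q hq j) p hp, ← pd_pullback j hEd p]
    exact congrArg (fun L => L (Pi.single j.succ (1 : ℝ))) (fderiv_add (hd p) (hd2 p))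
  have hlin : pd 0 (fun y => -pd 0 (A 0) y + ∑ j : Fin 3, pd j.succ (A j.succ) y) p
      = -pd 0 (pd 0 (A 0)) p + ∑ j : Fin 3, pd 0 (pd j.succ (A j.succ)) p := by
    have h0 := pd_differentiable 0 (hA 0) p
    have hj := fun j : Fin 3 => pd_differentiable j.succ (hA j.succ) p
    have H := (h0.hasFDerivAt.neg.add
      (HasFDerivAt.fun_sum (u := Finset.univ) fun j _ => (hj j).hasFDerivAt)).fderiv
    have H2 := congrArg (fun L => L (Pi.single (0 : Fin 4) (1 : ℝ))) H
    simp only [add_apply, neg_apply,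
      sum_apply] at H2
    exact H2
  rw [hlin, Finset.sum_congr rfl fun j _ => hterm j, Finset.sum_add_distrib, hGauss,
    Fin.sum_univ_three]
  have := hwave p
  simp only [Fin.succ_zero_eq_one, Fin.succ_one_eq_two,
    show (2 : Fin 3).succ = (3 : Fin 4) from rfl]
  linarith

end
end

section
/- Let h_{ab} : ℝ⁴ → ℝ be smooth and symmetric, let ξ_a : ℝ⁴ → ℝ be smooth, and set h̃_{ab} := h_{ab} + ∂_a ξ_b + ∂_b ξ_a. With the null frame K = ∂_t − ∂_x, Q = ∂_y + i∂_z, ∇_v := v^a∂_a, and subscripts denoting contraction with frame vectors via ℂ-bilinear extension (h_{KQ} := K^aQ^bh_{ab}, etc.), the ℂ-valued function ∇_K²h_{QQ} + ∇_Q(∇_Q h_{KK} − 2∇_K h_{KQ}) is gauge invariant: ∇_K²h̃_{QQ} + ∇_Q(∇_Q h̃_{KK} − 2∇_K h̃_{KQ}) = ∇_K²h_{QQ} + ∇_Q(∇_Q h_{KK} − 2∇_K h_{KQ}) at every point of ℝ⁴. -/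
noncomputable section

/-- Complex-valued partial derivative `∂_a f` on `ℝ⁴`. -/
def pdC (a : Fin 4) (f : (Fin 4 → ℝ) → ℂ) : (Fin 4 → ℝ) → ℂ :=
  fun x => fderiv ℝ f x (Pi.single a 1)

/-- Null frame vector `K = ∂_t − ∂_x`. -/
def Kv : Fin 4 → ℂ := ![1, -1, 0, 0]
/-- Null frame vector `Q = ∂_y + i ∂_z`. -/
def Qv : Fin 4 → ℂ := ![0, 0, 1, Complex.I]

/-- Directional derivative `∇_v f = v^a ∂_a f` (ℂ-bilinear extension). -/
def nab (v : Fin 4 → ℂ) (f : (Fin 4 → ℝ) → ℂ) : (Fin 4 → ℝ) → ℂ :=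
  fun x => ∑ a, v a * pdC a f x

/-- Frame contraction `h_{vw} = v^a w^b h_{ab}` (ℂ-bilinear extension). -/
def contr2 (h : Fin 4 → Fin 4 → (Fin 4 → ℝ) → ℝ) (v w : Fin 4 → ℂ) :
    (Fin 4 → ℝ) → ℂ :=
  fun x => ∑ a, ∑ b, v a * w b * (h a b x : ℂ)

abbrev Sm (f : (Fin 4 → ℝ) → ℂ) : Prop := ContDiff ℝ (⊤ : ℕ∞) f

lemma Sm.diff {f : (Fin 4 → ℝ) → ℂ} (hf : Sm f) : Differentiable ℝ f :=
  ContDiff.differentiable hf (by simp)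

lemma Sm.fd {f : (Fin 4 → ℝ) → ℂ} (hf : Sm f) : ContDiff ℝ (⊤ : ℕ∞) (fderiv ℝ f) :=
  ContDiff.fderiv_right hf (by simp)

lemma Sm.pdC {f : (Fin 4 → ℝ) → ℂ} (hf : Sm f) (a : Fin 4) : Sm (pdC a f) :=
  ContDiff.clm_apply hf.fd contDiff_const

lemma Sm.nab {f : (Fin 4 → ℝ) → ℂ} (hf : Sm f) (v : Fin 4 → ℂ) : Sm (nab v f) :=
  ContDiff.sum fun a _ => contDiff_const.mul (hf.pdC a)

lemma pdC_add {f g : (Fin 4 → ℝ) → ℂ} (hf : Sm f) (hg : Sm g) (a : Fin 4) (x : Fin 4 → ℝ) :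
    pdC a (fun y => f y + g y) x = pdC a f x + pdC a g x := by
  unfold pdC
  rw [fderiv_fun_add (hf.diff x) (hg.diff x)]
  rfl

lemma pdC_mul {f : (Fin 4 → ℝ) → ℂ} (hf : Sm f) (c : ℂ) (a : Fin 4) (x : Fin 4 → ℝ) :
    pdC a (fun y => c * f y) x = c * pdC a f x := by
  unfold pdC
  rw [fderiv_const_mul (hf.diff x) c]
  rfl

lemma pdC_sum {F : Fin 4 → (Fin 4 → ℝ) → ℂ} (hF : ∀ b, Sm (F b)) (v : Fin 4 → ℂ)
    (a : Fin 4) (x : Fin 4 → ℝ) :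
    pdC a (fun y => ∑ b, v b * F b y) x = ∑ b, v b * pdC a (F b) x := by
  have h : ∀ b ∈ (Finset.univ : Finset (Fin 4)),
      DifferentiableAt ℝ (fun y => v b * F b y) x :=
    fun b _ => ((hF b).diff x).const_mul (v b)
  have e : pdC a (fun y => ∑ b, v b * F b y) x = ∑ b, pdC a (fun y => v b * F b y) x := by
    unfold pdC
    rw [fderiv_fun_sum h]
    simp
  rw [e]
  exact Finset.sum_congr rfl fun b _ => pdC_mul (hF b) _ _ _

lemma nab_add {f g : (Fin 4 → ℝ) → ℂ} (hf : Sm f) (hg : Sm g) (v : Fin 4 → ℂ) :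
    nab v (fun y => f y + g y) = fun x => nab v f x + nab v g x := by
  funext x
  simp only [nab, pdC_add hf hg, mul_add, Finset.sum_add_distrib]

lemma nab_mul {f : (Fin 4 → ℝ) → ℂ} (hf : Sm f) (c : ℂ) (v : Fin 4 → ℂ) :
    nab v (fun y => c * f y) = fun x => c * nab v f x := by
  funext x
  simp only [nab, pdC_mul hf, Finset.mul_sum]
  exact Finset.sum_congr rfl fun b _ => by ring

lemma nab_sub2 {f g : (Fin 4 → ℝ) → ℂ} (hf : Sm f) (hg : Sm g) (v : Fin 4 → ℂ) :
    nab v (fun y => f y - 2 * g y) = fun x => nab v f x - 2 * nab v g x := by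
  have e : (fun y => f y - 2 * g y) = fun y => f y + (-2) * g y := by
    funext y; ring
  have hg' : Sm (fun y => (-2 : ℂ) * g y) := contDiff_const.mul hg
  rw [e, nab_add hf hg', nab_mul hg]
  funext x; ring

lemma pdC_comm {f : (Fin 4 → ℝ) → ℂ} (hf : Sm f) (a b : Fin 4) (x : Fin 4 → ℝ) :
    pdC a (pdC b f) x = pdC b (pdC a f) x := by
  have hd : DifferentiableAt ℝ (fderiv ℝ f) x := (hf.fd.differentiable (by simp)) x
  have key : ∀ a b : Fin 4, pdC a (pdC b f) x
      = fderiv ℝ (fderiv ℝ f) x (Pi.single a 1) (Pi.single b 1) := by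
    intro a b
    unfold pdC
    rw [fderiv_clm_apply hd (differentiableAt_const _)]
    simp
  rw [key, key]
  have hs : IsSymmSndFDerivAt ℝ f x :=
    (ContDiff.contDiffAt hf).isSymmSndFDerivAt (by
      simp only [minSmoothness_of_isRCLikeNormedField]; exact WithTop.coe_le_coe.2 (le_top : (2 : ℕ∞) ≤ ⊤))
  exact hs _ _

lemma nab_comm {f : (Fin 4 → ℝ) → ℂ} (hf : Sm f) (v w : Fin 4 → ℂ) :
    nab v (nab w f) = nab w (nab v f) := by
  have key : ∀ v w : Fin 4 → ℂ, ∀ x, nab v (nab w f) x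
      = ∑ a, ∑ b, v a * (w b * pdC a (pdC b f) x) := by
    intro v w x
    change ∑ a, v a * pdC a (fun y => ∑ b, w b * pdC b f y) x = _
    simp only [pdC_sum (fun b => hf.pdC b), Finset.mul_sum]
  funext x
  rw [key, key, Finset.sum_comm]
  refine Finset.sum_congr rfl fun a _ => Finset.sum_congr rfl fun b _ => ?_
  rw [pdC_comm hf]; ring

lemma sm_ofReal {f : (Fin 4 → ℝ) → ℝ} (hf : ContDiff ℝ (⊤ : ℕ∞) f) :
    Sm (fun x => (f x : ℂ)) :=
  Complex.ofRealCLM.contDiff.comp hf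

lemma pdC_ofReal {f : (Fin 4 → ℝ) → ℝ} (hf : ContDiff ℝ (⊤ : ℕ∞) f) (a : Fin 4)
    (x : Fin 4 → ℝ) : pdC a (fun x => (f x : ℂ)) x = (pd a f x : ℂ) := by
  have hd : DifferentiableAt ℝ f x := (hf.differentiable (by simp)) x
  have := (Complex.ofRealCLM.hasFDerivAt (x := f x)).comp x hd.hasFDerivAt
  unfold pdC pd
  have e : fderiv ℝ (fun x => (f x : ℂ)) x = Complex.ofRealCLM.comp (fderiv ℝ f x) :=
    this.fderiv
  rw [e]; rfl

/-- Contraction of a covector field with a frame vector. -/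
def contr1 (ξ : Fin 4 → (Fin 4 → ℝ) → ℝ) (v : Fin 4 → ℂ) : (Fin 4 → ℝ) → ℂ :=
  fun x => ∑ b, v b * (ξ b x : ℂ)

lemma sm_contr1 {ξ : Fin 4 → (Fin 4 → ℝ) → ℝ} (hξ : ∀ a, ContDiff ℝ (⊤ : ℕ∞) (ξ a))
    (v : Fin 4 → ℂ) : Sm (contr1 ξ v) :=
  ContDiff.sum fun a _ => contDiff_const.mul (sm_ofReal (hξ a))

lemma sm_contr2 {h : Fin 4 → Fin 4 → (Fin 4 → ℝ) → ℝ}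
    (hh : ∀ a b, ContDiff ℝ (⊤ : ℕ∞) (h a b)) (v w : Fin 4 → ℂ) : Sm (contr2 h v w) :=
  ContDiff.sum fun a _ => ContDiff.sum fun b _ => contDiff_const.mul (sm_ofReal (hh a b))

lemma nab_contr1 {ξ : Fin 4 → (Fin 4 → ℝ) → ℝ} (hξ : ∀ a, ContDiff ℝ (⊤ : ℕ∞) (ξ a))
    (v w : Fin 4 → ℂ) (x : Fin 4 → ℝ) :
    nab v (contr1 ξ w) x = ∑ a, ∑ b, v a * w b * (pd a (ξ b) x : ℂ) := by
  change ∑ a, v a * pdC a (fun y => ∑ b, w b * (ξ b y : ℂ)) x = _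
  simp only [pdC_sum (fun b => sm_ofReal (hξ b)), Finset.mul_sum, pdC_ofReal (hξ _), mul_assoc]

lemma contr2_gauge {h ht : Fin 4 → Fin 4 → (Fin 4 → ℝ) → ℝ}
    {ξ : Fin 4 → (Fin 4 → ℝ) → ℝ} (hξ : ∀ a, ContDiff ℝ (⊤ : ℕ∞) (ξ a))
    (hht : ∀ a b x, ht a b x = h a b x + pd a (ξ b) x + pd b (ξ a) x) (v w : Fin 4 → ℂ) :
    contr2 ht v w = fun x => contr2 h v w x + (nab v (contr1 ξ w) x + nab w (contr1 ξ v) x) := by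
  funext x
  rw [nab_contr1 hξ, nab_contr1 hξ, Finset.sum_comm (f := fun a b => w a * v b * _)]
  simp only [contr2, ← Finset.sum_add_distrib]
  refine Finset.sum_congr rfl fun a _ => Finset.sum_congr rfl fun b _ => ?_
  rw [hht]; push_cast; ring

lemma nab_contr2_gauge {h ht : Fin 4 → Fin 4 → (Fin 4 → ℝ) → ℝ}
    (hh : ∀ a b, ContDiff ℝ (⊤ : ℕ∞) (h a b))
    {ξ : Fin 4 → (Fin 4 → ℝ) → ℝ} (hξ : ∀ a, ContDiff ℝ (⊤ : ℕ∞) (ξ a))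
    (hht : ∀ a b x, ht a b x = h a b x + pd a (ξ b) x + pd b (ξ a) x)
    (u s v w : Fin 4 → ℂ) (x : Fin 4 → ℝ) :
    Sm (contr2 ht v w) ∧ nab u (nab s (contr2 ht v w)) x = nab u (nab s (contr2 h v w)) x
      + (nab u (nab s (nab v (contr1 ξ w))) x + nab u (nab s (nab w (contr1 ξ v))) x) := by
  have h0 := sm_contr2 hh v w
  have h1 := (sm_contr1 hξ w).nab v
  have h2 := (sm_contr1 hξ v).nab w
  have h12 : Sm (fun x => nab v (contr1 ξ w) x + nab w (contr1 ξ v) x) := ContDiff.add h1 h2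
  have h12' : Sm (fun x => nab s (nab v (contr1 ξ w)) x + nab s (nab w (contr1 ξ v)) x) :=
    ContDiff.add (h1.nab s) (h2.nab s)
  rw [contr2_gauge hξ hht]
  refine ⟨ContDiff.add h0 h12, ?_⟩
  rw [nab_add h0 h12, nab_add h1 h2, nab_add (h0.nab s) h12', nab_add (h1.nab s) (h2.nab s)]

/-- The Weyl-scalar combination `∇_K² h_{QQ} + ∇_Q(∇_Q h_{KK} − 2 ∇_K h_{KQ})` is invariant
under the infinitesimal coordinate transformation `h̃_{ab} = h_{ab} + ∂_a ξ_b + ∂_b ξ_a`. -/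
theorem weyl_scalar_boundary_data_gauge_invariant
    (h : Fin 4 → Fin 4 → (Fin 4 → ℝ) → ℝ)
    (hsmooth : ∀ a b, ContDiff ℝ (⊤ : ℕ∞) (h a b))
    (hsymm : ∀ a b x, h a b x = h b a x)
    (ξ : Fin 4 → (Fin 4 → ℝ) → ℝ) (hξ : ∀ a, ContDiff ℝ (⊤ : ℕ∞) (ξ a))
    (ht : Fin 4 → Fin 4 → (Fin 4 → ℝ) → ℝ)
    (hht : ∀ a b x, ht a b x = h a b x + pd a (ξ b) x + pd b (ξ a) x) :
    ∀ x : Fin 4 → ℝ,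
      nab Kv (nab Kv (contr2 ht Qv Qv)) x
          + nab Qv (fun y => nab Qv (contr2 ht Kv Kv) y - 2 * nab Kv (contr2 ht Kv Qv) y) x
        = nab Kv (nab Kv (contr2 h Qv Qv)) x
          + nab Qv (fun y => nab Qv (contr2 h Kv Kv) y - 2 * nab Kv (contr2 h Kv Qv) y) x := by
  intro x
  have G := nab_contr2_gauge hsmooth hξ hht
  rw [nab_sub2 ((G Kv Kv Kv Kv x).1.nab Qv) ((G Kv Kv Kv Qv x).1.nab Kv),
    nab_sub2 ((sm_contr2 hsmooth Kv Kv).nab Qv) ((sm_contr2 hsmooth Kv Qv).nab Kv)]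
  simp only [(G _ _ _ _ x).2]
  have sK := sm_contr1 hξ Kv
  have sQ := sm_contr1 hξ Qv
  rw [nab_comm sQ Kv Qv, nab_comm (sQ.nab Kv) Kv Qv, nab_comm sK Kv Qv]
  ring

end
end

section
/- Let h_{ab} : ℝ⁴ → ℝ be smooth and symmetric, let η = diag(−1,1,1,1), and let H_a := η^{bc}∂_b(h_{ca} − ½η_{ca}η^{ef}h_{ef}) be the harmonic constraint. With the null frame K = ∂_t − ∂_x, L = ∂_t + ∂_x, Q = ∂_y + i∂_z, Q̄ = ∂_y − i∂_z, ∇_v := v^a∂_a, and subscripts denoting contraction with frame vectors via ℂ-bilinear extension, the following holds at each point p ∈ ℝ⁴: the three equations ∇_K h_{QQ̄} = −∇_L h_{KK} + ∇_Q h_{KQ̄} + ∇_{Q̄} h_{KQ}, ∇_K h_{LQ} = −∇_L h_{KQ} + ∇_Q h_{KL} + ∇_{Q̄} h_{QQ}, and ∇_K h_{LL} = −∇_L h_{QQ̄} + ∇_Q h_{LQ̄} + ∇_{Q̄} h_{LQ} hold simultaneously at p if and only if H_a(p) = 0 for all a = 0,1,2,3. -/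
noncomputable section

/-- Diagonal entries of the Minkowski metric `η = diag(−1,1,1,1)`. -/
def etaV : Fin 4 → ℝ := ![-1, 1, 1, 1]

/-- The Minkowski metric (and its inverse) as a matrix `η_{ab} = η^{ab}`. -/
def etaM : Fin 4 → Fin 4 → ℝ := fun a b => if a = b then etaV a else 0

/-- The trace `η^{ef} h_{ef}`. -/
def trH (h : Fin 4 → Fin 4 → (Fin 4 → ℝ) → ℝ) : (Fin 4 → ℝ) → ℝ :=
  fun x => ∑ e, ∑ f, etaM e f * h e f x

/-- The harmonic constraint `H_a = η^{bc} ∂_b (h_{ca} − ½ η_{ca} η^{ef} h_{ef})`. -/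
def harmonicH (h : Fin 4 → Fin 4 → (Fin 4 → ℝ) → ℝ) (a : Fin 4) : (Fin 4 → ℝ) → ℝ :=
  fun x => ∑ b, ∑ c, etaM b c * pd b (fun y => h c a y - (1/2) * etaM c a * trH h y) x

/-- Null frame vector `L = ∂_t + ∂_x`. -/
def Lv : Fin 4 → ℂ := ![1, 1, 0, 0]
/-- Null frame vector `Q̄ = ∂_y − i ∂_z`. -/
def Qbv : Fin 4 → ℂ := ![0, 0, 1, -Complex.I]

theorem nab_contr2 (h : Fin 4 → Fin 4 → (Fin 4 → ℝ) → ℝ)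
    (hd : ∀ a b, Differentiable ℝ (h a b)) (u v w : Fin 4 → ℂ) (p : Fin 4 → ℝ) :
    nab u (contr2 h v w) p
      = ∑ c, u c * ∑ a, ∑ b, v a * w b * ((pd c (h a b) p : ℝ) : ℂ) := by
  have key : HasFDerivAt (contr2 h v w)
      (∑ a, ∑ b, (v a * w b) • (Complex.ofRealCLM.comp (fderiv ℝ (h a b) p))) p := by
    unfold contr2
    refine HasFDerivAt.fun_sum fun a _ => HasFDerivAt.fun_sum fun b _ => ?_
    exact (Complex.ofRealCLM.hasFDerivAt.comp p (hd a b p).hasFDerivAt).const_mul (v a * w b)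
  unfold nab pdC pd
  rw [key.fderiv]
  simp

theorem harmonicH_eq (h : Fin 4 → Fin 4 → (Fin 4 → ℝ) → ℝ)
    (hd : ∀ a b, Differentiable ℝ (h a b)) (a : Fin 4) (p : Fin 4 → ℝ) :
    harmonicH h a p = ∑ b, ∑ c, etaM b c *
      (pd b (h c a) p - (1/2) * etaM c a * ∑ e, ∑ f, etaM e f * pd b (h e f) p) := by
  unfold harmonicH
  refine Finset.sum_congr rfl fun b _ => Finset.sum_congr rfl fun c _ => ?_
  have key : HasFDerivAt (fun y => h c a y - (1/2) * etaM c a * trH h y)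
      (fderiv ℝ (h c a) p - ((1/2) * etaM c a) •
        ∑ e, ∑ f, etaM e f • fderiv ℝ (h e f) p) p := by
    refine (hd c a p).hasFDerivAt.sub (HasFDerivAt.const_mul ?_ _)
    unfold trH
    refine HasFDerivAt.fun_sum fun e _ => HasFDerivAt.fun_sum fun f _ => ?_
    exact (hd e f p).hasFDerivAt.const_mul _
  unfold pd
  rw [key.fderiv]
  simp

/-- The three constraint-preserving boundary conditions
`∇_K h_{QQ̄} = −∇_L h_{KK} + ∇_Q h_{KQ̄} + ∇_Q̄ h_{KQ}`,
`∇_K h_{LQ} = −∇_L h_{KQ} + ∇_Q h_{KL} + ∇_Q̄ h_{QQ}`,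
`∇_K h_{LL} = −∇_L h_{QQ̄} + ∇_Q h_{LQ̄} + ∇_Q̄ h_{LQ}`
hold simultaneously at a point `p` iff the harmonic constraint `H_a(p) = 0` for all `a`. -/
theorem constraint_preserving_bc_iff_harmonic_constraint
    (h : Fin 4 → Fin 4 → (Fin 4 → ℝ) → ℝ)
    (hsmooth : ∀ a b, ContDiff ℝ (⊤ : ℕ∞) (h a b))
    (hsymm : ∀ a b x, h a b x = h b a x) :
    ∀ p : Fin 4 → ℝ,
      ((nab Kv (contr2 h Qv Qbv) p
          = -nab Lv (contr2 h Kv Kv) p + nab Qv (contr2 h Kv Qbv) p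
            + nab Qbv (contr2 h Kv Qv) p) ∧
       (nab Kv (contr2 h Lv Qv) p
          = -nab Lv (contr2 h Kv Qv) p + nab Qv (contr2 h Kv Lv) p
            + nab Qbv (contr2 h Qv Qv) p) ∧
       (nab Kv (contr2 h Lv Lv) p
          = -nab Lv (contr2 h Qv Qbv) p + nab Qv (contr2 h Lv Qbv) p
            + nab Qbv (contr2 h Lv Qv) p))
      ↔ (∀ a : Fin 4, harmonicH h a p = 0) := by
  intro p
  have hd : ∀ a b, Differentiable ℝ (h a b) := fun a b =>
    (hsmooth a b).differentiable (by simp)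
  have hs : ∀ a b, h a b = h b a := fun a b => funext (hsymm a b)
  simp only [nab_contr2 h hd, harmonicH_eq h hd]
  have hD : ∀ c a b, pd c (h a b) p = pd c (h b a) p := fun c a b => by rw [hs a b]
  generalize hDD : (fun c a b => pd c (h a b) p) = D
  have hE : ∀ c a b, pd c (h a b) p = D c a b := fun c a b => by rw [← hDD]
  simp only [hE] at hD ⊢
  have h10 := fun c => hD c 1 0
  have h20 := fun c => hD c 2 0
  have h30 := fun c => hD c 3 0
  have h21 := fun c => hD c 2 1
  have h31 := fun c => hD c 3 1
  have h32 := fun c => hD c 3 2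
  clear hD hE hDD
  simp only [Fin.forall_fin_succ, Fin.sum_univ_four, Complex.ext_iff]
  simp [Kv, Lv, Qv, Qbv, etaM, etaV, h10, h20, h30, h21, h31, h32]
  constructor
  · rintro ⟨h1, ⟨h2, h3⟩, h4⟩
    refine ⟨?_, ?_, ?_, ?_⟩ <;> linarith
  · rintro ⟨h1, h2, h3, h4⟩
    refine ⟨?_, ⟨?_, ?_⟩, ?_⟩ <;> first | linarith | (constructor <;> linarith)

end
end
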